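/- arXiv:1910.04276 — 2 statements merged into one kernel-verified Lean document; each statement's English description precedes it below -/
import Mathlib

section
/- Let α, β ∈ (0,1) with α + β < 1, set L₁ = α/(1−α−β) and L₂ = β/(1−α−β), and let f be a Schwartz function on ℝ with f(n^α) = f(-n^α) = 0 and f̂(n^β) = f̂(-n^β) = 0 for every natural number n ≥ 0. Then for every ε > 0 there exist constants C, c > 0 such that |f(x)| ≤ C e^{−c|x|^{1/(L₁+ε)}} and |f̂(ξ)| ≤ C e^{−c|ξ|^{1/(L₂+ε)}} for all x, ξ ∈ ℝ. -/
open MeasureTheory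

/-- The Fourier transform `f̂(ξ) = ∫_ℝ f(x) e^{2πi x ξ} dx`. -/
noncomputable def fourierTransform (f : ℝ → ℂ) (ξ : ℝ) : ℂ :=
  ∫ x : ℝ, f x * Complex.exp (2 * Real.pi * Complex.I * x * ξ)

theorem exists_iteratedDeriv_eq_zero_of_zeros (n : ℕ) (f : ℝ → ℝ) (hf : ContDiff ℝ n f)
    (z : ℕ → ℝ) (hz : ∀ i < n, z i < z (i + 1)) (hfz : ∀ i ≤ n, f (z i) = 0) :
    ∃ ξ, iteratedDeriv n f ξ = 0 := by
  induction n generalizing f z with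
  | zero => exact ⟨z 0, by simpa using hfz 0 le_rfl⟩
  | succ n ih =>
    have rolle : ∀ i < n + 1, ∃ w ∈ Set.Ioo (z i) (z (i + 1)), deriv f w = 0 := fun i hi =>
      exists_deriv_eq_zero (hz i hi) hf.continuous.continuousOn
        (by rw [hfz i hi.le, hfz (i + 1) hi])
    choose! w hw hw0 using rolle
    rw [iteratedDeriv_succ']
    refine ih (deriv f) ((contDiff_succ_iff_deriv (n := (n : WithTop ℕ∞))).1 (mod_cast hf)).2.2 w
      (fun i hi => ?_) fun i hi => hw0 i (by omega)
    exact (hw i (by omega)).2.trans (hw (i + 1) (by omega)).1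

theorem iteratedDeriv_eval_of_monic (p : Polynomial ℝ) (hp : p.Monic) (t : ℝ) :
    iteratedDeriv p.natDegree (fun x => p.eval x) t = p.natDegree.factorial := by
  have key : ∀ n : ℕ, iteratedDeriv n (fun x => p.eval x) =
      fun x => (Polynomial.derivative^[n] p).eval x := by
    intro n
    induction n with
    | zero => simp
    | succ n ih =>
      rw [iteratedDeriv_succ, ih]
      funext x
      rw [Polynomial.deriv, Function.iterate_succ_apply']
  have hdeg := Polynomial.natDegree_iterate_derivative p p.natDegree
  rw [Nat.sub_self] at hdeg
  rw [key, Polynomial.eq_C_of_natDegree_le_zero hdeg]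
  simp [Polynomial.coeff_iterate_derivative, hp.coeff_natDegree, Nat.descFactorial_self]

/-- Error formula for Lagrange interpolation of a function at its zeros `z 1, …, z n`. -/
theorem exists_mul_factorial_eq_iteratedDeriv_mul_prod (n : ℕ) (f : ℝ → ℝ) (hf : ContDiff ℝ n f)
    (z : ℕ → ℝ) (hz : ∀ i < n, z i < z (i + 1)) (hfz : ∀ i < n, f (z (i + 1)) = 0) :
    ∃ ξ, f (z 0) * n.factorial =
      iteratedDeriv n f ξ * ∏ i ∈ Finset.range n, (z 0 - z (i + 1)) := by
  set p : Polynomial ℝ :=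
    ∏ i ∈ Finset.range n, (Polynomial.X - Polynomial.C (z (i + 1))) with hp
  have hmonic : p.Monic := Polynomial.monic_prod_of_monic _ _ fun i _ => Polynomial.monic_X_sub_C _
  have hdeg : p.natDegree = n := by simp [hp]
  have hpz : p.eval (z 0) = ∏ i ∈ Finset.range n, (z 0 - z (i + 1)) := by
    simp [hp, Polynomial.eval_prod]
  have hpc : ContDiff ℝ n (fun x => p.eval x) := by simpa using p.contDiff_aeval (𝕜 := ℝ) n
  obtain ⟨ξ, hξ⟩ := exists_iteratedDeriv_eq_zero_of_zeros n
    (fun t => p.eval (z 0) * f t - f (z 0) * p.eval t) (by fun_prop) z hz (by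
      rintro (_ | i) hi
      · ring
      · have : p.eval (z (i + 1)) = 0 := by
          rw [hp, Polynomial.eval_prod]
          exact Finset.prod_eq_zero (Finset.mem_range.2 hi) (by simp)
        simp [this, hfz i hi])
  have hmon := iteratedDeriv_eval_of_monic p hmonic ξ
  rw [hdeg] at hmon
  rw [iteratedDeriv_fun_sub (by fun_prop) (by fun_prop), iteratedDeriv_const_mul_field,
    iteratedDeriv_const_mul_field, hmon, hpz] at hξ
  exact ⟨ξ, by linarith⟩

theorem norm_mul_factorial_le_of_zeros {n : ℕ} {u : ℝ → ℂ} (hu : ContDiff ℝ n u) {S : ℝ}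
    (hS : ∀ t, ‖iteratedDeriv n u t‖ ≤ S) {z : ℕ → ℝ} (hz : ∀ i < n, z i < z (i + 1))
    (huz : ∀ i < n, u (z (i + 1)) = 0) {h : ℝ} (hh : ∀ i < n, |z 0 - z (i + 1)| ≤ h) :
    ‖u (z 0)‖ * n.factorial ≤ S * h ^ n := by
  obtain ⟨g, hg, hgu⟩ := exists_dual_vector'' ℝ (u (z 0))
  obtain ⟨ξ, hξ⟩ := exists_mul_factorial_eq_iteratedDeriv_mul_prod n (fun t => g (u t))
    (g.contDiff.comp hu) z hz (fun i hi => by simp [huz i hi])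
  have hd : |iteratedDeriv n (fun t => g (u t)) ξ| ≤ S := by
    have h1 := g.norm_iteratedFDeriv_comp_left (hu.contDiffAt (x := ξ)) le_rfl
    rw [norm_iteratedFDeriv_eq_norm_iteratedDeriv, norm_iteratedFDeriv_eq_norm_iteratedDeriv] at h1
    calc _ ≤ ‖g‖ * ‖iteratedDeriv n u ξ‖ := h1
      _ ≤ 1 * ‖iteratedDeriv n u ξ‖ := by gcongr
      _ ≤ S := by simpa using hS ξ
  have hp : |∏ i ∈ Finset.range n, (z 0 - z (i + 1))| ≤ h ^ n := by
    rw [Finset.abs_prod]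
    calc _ ≤ ∏ _i ∈ Finset.range n, h :=
          Finset.prod_le_prod (fun _ _ => abs_nonneg _) fun i hi => hh i (Finset.mem_range.1 hi)
      _ = h ^ n := by simp
  have hgu' : g (u (z 0)) = ‖u (z 0)‖ := by simpa using hgu
  simp only [hgu'] at hξ
  rw [hξ]
  refine (le_abs_self _).trans ?_
  rw [abs_mul]
  exact mul_le_mul hd hp (abs_nonneg _) ((abs_nonneg _).trans hd)

theorem add_rpow_sub_rpow_le {a x y : ℝ} (ha : 0 ≤ a) (ha1 : a ≤ 1) (hx : 0 < x) (hy : 0 ≤ y) :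
    (x + y) ^ a - x ^ a ≤ y * x ^ (a - 1) := by
  have h1 := rpow_one_add_le_one_add_mul_self (s := y / x)
    (by linarith [div_nonneg hy hx.le]) ha ha1
  have h2 : (x + y) ^ a = x ^ a * (1 + y / x) ^ a := by
    rw [← Real.mul_rpow hx.le (by positivity)]
    congr 1
    field_simp
  have h3 : x ^ (a - 1) = x ^ a / x := by rw [Real.rpow_sub hx, Real.rpow_one]
  have h4 : 0 < x ^ a := by positivity
  calc (x + y) ^ a - x ^ a ≤ x ^ a * (1 + a * (y / x)) - x ^ a := by rw [h2]; gcongr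
    _ = a * (y * (x ^ a / x)) := by ring
    _ ≤ 1 * (y * (x ^ a / x)) := by gcongr
    _ = _ := by rw [h3, one_mul]

theorem norm_le_rpow_of_zeros_of_one_le {a : ℝ} (ha : a ∈ Set.Ioo (0 : ℝ) 1) {n : ℕ} {u : ℝ → ℂ}
    (hu : ContDiff ℝ n u) {S : ℝ} (hS : ∀ t, ‖iteratedDeriv n u t‖ ≤ S)
    (hz : ∀ m : ℕ, u ((m : ℝ) ^ a) = 0) {x : ℝ} (hx : 1 ≤ x) :
    ‖u x‖ * x ^ ((1 / a - 1) * n) ≤ (2 * Real.exp 1) ^ n * S := by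
  obtain ⟨ha0, ha1⟩ := ha
  have hx0 : 0 < x := by linarith
  have hS0 : 0 ≤ S := (norm_nonneg _).trans (hS 0)
  set y : ℝ := x ^ (1 / a) with hy
  have hy1 : 1 ≤ y := Real.one_le_rpow hx (by positivity)
  have hya : y ^ a = x := by rw [hy, ← Real.rpow_mul hx0.le]; field_simp; simp
  set N : ℕ := ⌊y⌋₊ with hN
  have hN1 : 1 ≤ N := Nat.le_floor (by simpa using hy1)
  have hN1' : (1 : ℝ) ≤ N := by exact_mod_cast hN1
  have hNy : (N : ℝ) ≤ y := Nat.floor_le (by linarith)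
  have hyN : y < N + 1 := Nat.lt_floor_add_one y
  let z : ℕ → ℝ := fun i => i.casesOn x fun i => ((N + 1 + i : ℕ) : ℝ) ^ a
  have hNa : (N : ℝ) ^ a ≤ x := by rw [← hya]; gcongr
  have hxz : ∀ i : ℕ, x < ((N + 1 + i : ℕ) : ℝ) ^ a := by
    intro i
    rw [← hya]
    refine Real.rpow_lt_rpow (by linarith) ?_ ha0
    push_cast
    linarith [(Nat.cast_nonneg i : (0 : ℝ) ≤ i)]
  have hgap : (N : ℝ) ^ (a - 1) ≤ 2 * x ^ (-(1 / a - 1)) := by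
    have e : y ^ (a - 1) = x ^ (-(1 / a - 1)) := by
      rw [hy, ← Real.rpow_mul hx0.le]; congr 1; field_simp; ring
    have h2 : ((2 : ℝ)⁻¹) ^ (a - 1) ≤ 2 := by
      rw [Real.inv_rpow (by norm_num), ← Real.rpow_neg (by norm_num)]
      calc (2 : ℝ) ^ (-(a - 1)) ≤ 2 ^ (1 : ℝ) :=
            Real.rpow_le_rpow_of_exponent_le (by norm_num) (by linarith)
        _ = 2 := by simp
    calc (N : ℝ) ^ (a - 1) ≤ (2⁻¹ * y) ^ (a - 1) :=
          Real.rpow_le_rpow_of_nonpos (by positivity) (by linarith) (by linarith)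
      _ = (2⁻¹) ^ (a - 1) * y ^ (a - 1) := Real.mul_rpow (by norm_num) (by linarith)
      _ ≤ 2 * x ^ (-(1 / a - 1)) := by rw [e]; gcongr
  have key := norm_mul_factorial_le_of_zeros (z := z) (h := n * (2 * x ^ (-(1 / a - 1)))) hu hS
    (by
      rintro (_ | i) _
      · exact hxz 0
      · exact Real.rpow_lt_rpow (by positivity) (by push_cast; linarith) ha0)
    (fun i _ => hz _)
    (by
      intro i hi
      have hi' : (i : ℝ) + 1 ≤ n := by exact_mod_cast hi
      change |x - ((N + 1 + i : ℕ) : ℝ) ^ a| ≤ _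
      rw [abs_sub_comm, abs_of_pos (sub_pos.2 (hxz i))]
      have h1 := add_rpow_sub_rpow_le ha0.le ha1.le (by linarith : (0 : ℝ) < N)
        (by positivity : (0 : ℝ) ≤ i + 1)
      have h2 : ((N + 1 + i : ℕ) : ℝ) = N + (i + 1) := by push_cast; ring
      rw [h2]
      calc _ ≤ ((N : ℝ) + (i + 1)) ^ a - (N : ℝ) ^ a := by linarith
        _ ≤ (i + 1) * (N : ℝ) ^ (a - 1) := h1
        _ ≤ n * (2 * x ^ (-(1 / a - 1))) := by gcongr)
  have hfac : (n : ℝ) ^ n ≤ Real.exp 1 ^ n * n.factorial := by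
    have h1 := Real.pow_div_factorial_le_exp (n : ℝ) (Nat.cast_nonneg n) n
    rwa [div_le_iff₀ (by positivity), ← Real.exp_one_pow] at h1
  have hw : (x ^ (-(1 / a - 1))) ^ n * x ^ ((1 / a - 1) * n) = 1 := by
    rw [← Real.rpow_mul_natCast hx0.le, ← Real.rpow_add hx0, ← add_mul, neg_add_cancel, zero_mul,
      Real.rpow_zero]
  have hxp : 0 ≤ x ^ ((1 / a - 1) * n) := by positivity
  have hfp : (0 : ℝ) < n.factorial := by positivity
  refine le_of_mul_le_mul_right ?_ hfp
  calc ‖u x‖ * x ^ ((1 / a - 1) * n) * n.factorial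
      = ‖u (z 0)‖ * n.factorial * x ^ ((1 / a - 1) * n) := mul_right_comm _ _ _
    _ ≤ S * (n * (2 * x ^ (-(1 / a - 1)))) ^ n * x ^ ((1 / a - 1) * n) := by gcongr
    _ = S * ((n : ℝ) ^ n * 2 ^ n) * ((x ^ (-(1 / a - 1))) ^ n * x ^ ((1 / a - 1) * n)) := by
        rw [mul_pow, mul_pow]; ring
    _ ≤ S * (Real.exp 1 ^ n * n.factorial * 2 ^ n) * 1 := by rw [hw]; gcongr
    _ = (2 * Real.exp 1) ^ n * S * n.factorial := by rw [mul_pow]; ring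

theorem norm_le_rpow_of_zeros {a : ℝ} (ha : a ∈ Set.Ioo (0 : ℝ) 1) {n : ℕ} {u : ℝ → ℂ}
    (hu : ContDiff ℝ n u) {S : ℝ} (hS : ∀ t, ‖iteratedDeriv n u t‖ ≤ S)
    (hz : ∀ m : ℕ, u ((m : ℝ) ^ a) = 0 ∧ u (-(m : ℝ) ^ a) = 0) {x : ℝ} (hx : 1 ≤ |x|) :
    ‖u x‖ * |x| ^ ((1 / a - 1) * n) ≤ (2 * Real.exp 1) ^ n * S := by
  rcases le_total 0 x with h | h
  · rw [abs_of_nonneg h] at hx ⊢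
    exact norm_le_rpow_of_zeros_of_one_le ha hu hS (fun m => (hz m).1) hx
  · rw [abs_of_nonpos h] at hx ⊢
    have := norm_le_rpow_of_zeros_of_one_le (u := fun t => u (-t)) ha (hu.comp contDiff_neg)
      (S := S) (fun t => by rw [iteratedDeriv_comp_neg]; simpa [norm_smul] using hS (-t))
      (fun m => (hz m).2) hx
    simpa using this

/-- The absolute moments of a function on the line. -/
noncomputable def absMoment (u : ℝ → ℂ) (k : ℕ) : ℝ := ∫ t : ℝ, |t| ^ k * ‖u t‖

theorem absMoment_nonneg (u : ℝ → ℂ) (k : ℕ) : 0 ≤ absMoment u k :=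
  integral_nonneg fun _ => by positivity

theorem absMoment_comp_neg (u : ℝ → ℂ) (k : ℕ) : absMoment (fun t => u (-t)) k = absMoment u k := by
  simpa [absMoment] using integral_neg_eq_self (fun t : ℝ => |t| ^ k * ‖u t‖) volume

open FourierTransform in
theorem norm_iteratedDeriv_fourier_le (v : SchwartzMap ℝ ℂ) (n : ℕ) (t : ℝ) :
    ‖iteratedDeriv n (𝓕 (v : ℝ → ℂ)) t‖ ≤ (2 * Real.pi) ^ n * absMoment v n := by
  have hint : ∀ k : ℕ, Integrable (fun x : ℝ => x ^ k • v x) := fun k => by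
    have h := v.integrable_pow_mul volume k
    refine h.mono (by fun_prop) (by simp)
  rw [Real.iteratedDeriv_fourier (N := ⊤) (fun k _ => hint k) le_top]
  refine (VectorFourier.norm_fourierIntegral_le_integral_norm _ _ _ _ _).trans (le_of_eq ?_)
  rw [absMoment, ← integral_const_mul]
  congr 1
  funext x
  simp [mul_pow, abs_of_pos Real.pi_pos, mul_assoc]

theorem absMoment_le_of_decay {u : ℝ → ℂ} {M W : ℝ} {j : ℕ} (hM : ∀ t, ‖u t‖ ≤ M)
    (hW : ∀ t, 1 ≤ |t| → |t| ^ (j + 2) * ‖u t‖ ≤ W) :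
    absMoment u j ≤ 2 * Real.pi * (M + W) := by
  have hM0 : 0 ≤ M := (norm_nonneg _).trans (hM 0)
  have hW0 : 0 ≤ W := le_trans (by positivity) (hW 1 (by simp))
  have hpt : ∀ t : ℝ, |t| ^ j * ‖u t‖ ≤ 2 * (M + W) * (1 + t ^ 2)⁻¹ := by
    intro t
    rw [← div_eq_mul_inv, le_div_iff₀ (by positivity), ← sq_abs]
    have h0 : 0 ≤ |t| ^ j * ‖u t‖ := by positivity
    rcases le_total 1 |t| with h | h
    · have h1 := hW t h
      have h2 : 1 ≤ |t| ^ 2 := one_le_pow₀ h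
      calc |t| ^ j * ‖u t‖ * (1 + |t| ^ 2) ≤ |t| ^ j * ‖u t‖ * (|t| ^ 2 + |t| ^ 2) := by gcongr
        _ = 2 * (|t| ^ (j + 2) * ‖u t‖) := by ring
        _ ≤ 2 * (M + W) := by linarith
    · have h1 : |t| ^ j ≤ 1 := pow_le_one₀ (abs_nonneg _) h
      have h2 : |t| ^ 2 ≤ 1 := pow_le_one₀ (abs_nonneg _) h
      calc |t| ^ j * ‖u t‖ * (1 + |t| ^ 2) ≤ 1 * M * (1 + 1) := by gcongr; exact hM t
        _ ≤ 2 * (M + W) := by linarith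
  calc absMoment u j ≤ ∫ t : ℝ, 2 * (M + W) * (1 + t ^ 2)⁻¹ :=
        integral_mono_of_nonneg (Filter.Eventually.of_forall fun t => by positivity)
          (integrable_inv_one_add_sq.const_mul _) (Filter.Eventually.of_forall hpt)
    _ = 2 * Real.pi * (M + W) := by
        rw [integral_const_mul, integral_univ_inv_one_add_sq]; ring

open FourierTransform in
theorem fourier_mul_rpow_le {a : ℝ} (ha : a ∈ Set.Ioo (0 : ℝ) 1) (v : SchwartzMap ℝ ℂ) {u : ℝ → ℂ}
    (huv : u = 𝓕 (v : ℝ → ℂ)) (hz : ∀ m : ℕ, u ((m : ℝ) ^ a) = 0 ∧ u (-(m : ℝ) ^ a) = 0) (n : ℕ)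
    {x : ℝ} (hx : 1 ≤ |x|) :
    ‖u x‖ * |x| ^ ((1 / a - 1) * n) ≤ (4 * Real.exp 1 * Real.pi) ^ n * absMoment v n := by
  have hu : ContDiff ℝ n u := by
    rw [huv, ← SchwartzMap.fourier_coe]
    exact (𝓕 v).smooth n
  refine (norm_le_rpow_of_zeros ha hu
    (fun t => by rw [huv]; exact norm_iteratedDeriv_fourier_le v n t) hz hx).trans (le_of_eq ?_)
  rw [← mul_assoc, ← mul_pow]
  ring

open FourierTransform in
theorem exists_absMoment_fourier_le {a : ℝ} (ha : a ∈ Set.Ioo (0 : ℝ) 1) (v : SchwartzMap ℝ ℂ)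
    {u : ℝ → ℂ} (huv : u = 𝓕 (v : ℝ → ℂ))
    (hz : ∀ m : ℕ, u ((m : ℝ) ^ a) = 0 ∧ u (-(m : ℝ) ^ a) = 0) :
    ∃ D : ℝ, 1 ≤ D ∧ ∀ j k : ℕ, (j : ℝ) + 2 ≤ (1 / a - 1) * k →
      1 + absMoment u j ≤ D ^ (k + 1) * (1 + absMoment v k) := by
  set M := ∫ t : ℝ, ‖v t‖
  have hM0 : 0 ≤ M := integral_nonneg fun _ => norm_nonneg _
  have hM : ∀ t, ‖u t‖ ≤ M := fun t => by
    rw [huv]; exact VectorFourier.norm_fourierIntegral_le_integral_norm _ _ _ _ _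
  set G := 4 * Real.exp 1 * Real.pi with hG
  have hG1 : 1 ≤ G := by
    have := Real.pi_gt_three
    have := Real.add_one_le_exp (1 : ℝ)
    nlinarith
  set E := 1 + 2 * Real.pi * M + 2 * Real.pi with hE
  have hp := Real.pi_pos
  have hE1 : 1 ≤ E := by
    have : 0 ≤ 2 * Real.pi * M := by positivity
    linarith
  refine ⟨E * G, one_le_mul_of_one_le_of_one_le hE1 hG1, fun j k hjk => ?_⟩
  have hm := absMoment_nonneg v k
  have hdecay := absMoment_le_of_decay (W := G ^ k * absMoment v k) (j := j) hM fun t ht => by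
    refine le_trans ?_ (fourier_mul_rpow_le ha v huv hz k ht)
    rw [mul_comm]
    gcongr
    rw [← Real.rpow_natCast]
    exact Real.rpow_le_rpow_of_exponent_le ht (by push_cast; exact hjk)
  have hGk : 1 ≤ G ^ k := one_le_pow₀ hG1
  calc 1 + absMoment u j ≤ (1 + 2 * Real.pi * M) * 1 + 2 * Real.pi * (G ^ k * absMoment v k) := by
        linarith
    _ ≤ (1 + 2 * Real.pi * M) * (G ^ k * (1 + absMoment v k)) +
        2 * Real.pi * (G ^ k * (1 + absMoment v k)) := by
        gcongr
        · exact one_le_mul_of_one_le_of_one_le hGk (by linarith)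
        · linarith
    _ = E * (G ^ k * (1 + absMoment v k)) := by ring
    _ ≤ (E * G) ^ (k + 1) * (1 + absMoment v k) := by
        rw [mul_pow E G, ← mul_assoc]
        gcongr
        · exact le_self_pow₀ hE1 (Nat.succ_ne_zero k)
        · exact Nat.le_succ k

theorem exists_le_pow_of_recursive {P : ℕ → ℝ} {E θ c : ℝ} (hE : 1 ≤ E) (hθ : θ < 1)
    (hP0 : ∀ j, 0 ≤ P j)
    (hP : ∀ j : ℕ, ∃ l : ℕ, (l : ℝ) ≤ θ * j + c ∧ P j ≤ E ^ (j + 1) * P l) :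
    ∃ K : ℝ, 1 ≤ K ∧ ∀ j, P j ≤ K ^ (j + 1) := by
  obtain ⟨δ, hδ, rfl⟩ : ∃ δ : ℝ, 0 < δ ∧ θ = 1 - δ := ⟨1 - θ, by linarith, by ring⟩
  obtain ⟨J, hJ⟩ := exists_nat_ge ((2 * c + δ) / δ)
  obtain ⟨m, hm⟩ := exists_nat_ge (2 / δ)
  rw [div_le_iff₀ hδ] at hJ hm
  have hsum : 0 ≤ ∑ i ∈ Finset.range J, |P i| := Finset.sum_nonneg fun _ _ => abs_nonneg _
  have hEm : 1 ≤ E ^ m := one_le_pow₀ hE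
  set K := E ^ m + ∑ i ∈ Finset.range J, |P i| with hK
  have hK1 : 1 ≤ K := by linarith
  refine ⟨K, hK1, fun j => ?_⟩
  induction j using Nat.strong_induction_on with
  | _ j ih =>
    rcases lt_or_ge j J with hj | hj
    · calc P j ≤ |P j| := le_abs_self _
        _ ≤ ∑ i ∈ Finset.range J, |P i| :=
          Finset.single_le_sum (f := fun i => |P i|) (fun _ _ => abs_nonneg _)
            (Finset.mem_range.2 hj)
        _ ≤ K := by linarith
        _ ≤ K ^ (j + 1) := le_self_pow₀ hK1 (by omega)
    · obtain ⟨l, hl, hPl⟩ := hP j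
      have hj' : (J : ℝ) ≤ j := by exact_mod_cast hj
      have hgap : δ * (j + 1) ≤ 2 * ((j : ℝ) - l) := by nlinarith
      have hlj : l < j := by
        have : 0 < δ * ((j : ℝ) + 1) := by positivity
        have : (l : ℝ) < j := by linarith
        exact_mod_cast this
      obtain ⟨d, rfl⟩ := Nat.exists_eq_add_of_lt hlj
      have hmd : l + d + 1 + 1 ≤ m * (d + 1) := by
        have : ((l + d + 1 + 1 : ℕ) : ℝ) ≤ (m * (d + 1) : ℕ) := by
          push_cast at hgap ⊢
          have h1 : 0 ≤ (l : ℝ) + d + 1 + 1 := by positivity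
          have h2 : (0 : ℝ) ≤ m := by positivity
          nlinarith [mul_le_mul_of_nonneg_right hm h1, mul_le_mul_of_nonneg_left hgap h2]
        exact_mod_cast this
      calc P (l + d + 1) ≤ E ^ (l + d + 1 + 1) * P l := hPl
        _ ≤ E ^ (m * (d + 1)) * K ^ (l + 1) := by
          have := ih l hlj
          have := hP0 l
          gcongr
        _ ≤ K ^ (d + 1) * K ^ (l + 1) := by
          rw [pow_mul]
          gcongr
          linarith
        _ = K ^ (l + d + 1 + 1) := by ring

theorem exists_le_pow_of_mutually_recursive {P Q : ℕ → ℝ} {A B D D' : ℝ} (hA : 0 < A) (hB : 0 < B)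
    (hAB : 1 < A * B) (hD : 1 ≤ D) (hD' : 1 ≤ D') (hP0 : ∀ j, 0 ≤ P j)
    (hPQ : ∀ j k : ℕ, (j : ℝ) + 2 ≤ A * k → P j ≤ D ^ (k + 1) * Q k)
    (hQP : ∀ k l : ℕ, (k : ℝ) + 2 ≤ B * l → Q k ≤ D' ^ (l + 1) * P l) :
    ∃ K : ℝ, 1 ≤ K ∧ ∀ j, P j ≤ K ^ (j + 1) := by
  set c := (2 / A + 3) / B + 1 with hc
  have hc0 : 0 ≤ c := by positivity
  have hDD : 1 ≤ D * D' := one_le_mul_of_one_le_of_one_le hD hD'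
  obtain ⟨s, hs⟩ := exists_nat_ge (2 / A + 3 + c + 1)
  have hθ : 1 / (A * B) < 1 := by rw [div_lt_one (by positivity)]; exact hAB
  refine exists_le_pow_of_recursive (E := (D * D') ^ s) (θ := 1 / (A * B)) (c := c)
    (one_le_pow₀ hDD) hθ hP0 fun j => ?_
  set k := ⌈((j : ℝ) + 2) / A⌉₊ with hk
  set l := ⌈((k : ℝ) + 2) / B⌉₊ with hl
  have hjk : ((j : ℝ) + 2) / A ≤ k := Nat.le_ceil _
  have hkl : ((k : ℝ) + 2) / B ≤ l := Nat.le_ceil _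
  have hk' : (k : ℝ) ≤ (j + 2) / A + 1 := (Nat.ceil_lt_add_one (by positivity)).le
  have hl' : (l : ℝ) ≤ (k + 2) / B + 1 := (Nat.ceil_lt_add_one (by positivity)).le
  have hlj : (l : ℝ) ≤ 1 / (A * B) * j + c := by
    calc (l : ℝ) ≤ (k + 2) / B + 1 := hl'
      _ ≤ ((j + 2) / A + 1 + 2) / B + 1 := by gcongr
      _ = 1 / (A * B) * j + c := by rw [hc]; field_simp; ring
  refine ⟨l, hlj, ?_⟩
  have hks : k + 1 ≤ s * (j + 1) ∧ l + 1 ≤ s * (j + 1) := by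
    have hj0 : (0 : ℝ) ≤ j := by positivity
    have hA' : (0 : ℝ) < 1 / A := by positivity
    have e1 : 2 / A = 2 * (1 / A) := by ring
    have e2 : ((j : ℝ) + 2) / A = j * (1 / A) + 2 * (1 / A) := by ring
    have hs1 : (2 / A + 3 + c + 1) * ((j : ℝ) + 1) ≤ s * (j + 1) := by gcongr
    have h3 : 0 ≤ (j : ℝ) * (1 / A) := by positivity
    have h4 : 0 ≤ (j : ℝ) * c := by positivity
    have h5 : 1 / (A * B) * (j : ℝ) ≤ 1 * j := by gcongr
    constructor
    · have : ((k + 1 : ℕ) : ℝ) ≤ (s * (j + 1) : ℕ) := by push_cast; nlinarith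
      exact_mod_cast this
    · have : ((l + 1 : ℕ) : ℝ) ≤ (s * (j + 1) : ℕ) := by push_cast; nlinarith
      exact_mod_cast this
  rw [div_le_iff₀ hA] at hjk
  rw [div_le_iff₀ hB] at hkl
  have hPl := hP0 l
  calc P j ≤ D ^ (k + 1) * Q k := hPQ j k (by linarith)
    _ ≤ D ^ (k + 1) * (D' ^ (l + 1) * P l) := by gcongr; exact hQP k l (by linarith)
    _ ≤ D ^ (s * (j + 1)) * (D' ^ (s * (j + 1)) * P l) := by
        gcongr
        · exact hks.1
        · exact hks.2
    _ = ((D * D') ^ s) ^ (j + 1) * P l := by rw [← pow_mul, mul_pow]; ring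

open FourierTransform in
theorem fourier_eq_zero_of_absMoment_le_pow {a : ℝ} (ha : a ∈ Set.Ioo (0 : ℝ) 1)
    (v : SchwartzMap ℝ ℂ) {u : ℝ → ℂ} (huv : u = 𝓕 (v : ℝ → ℂ))
    (hz : ∀ m : ℕ, u ((m : ℝ) ^ a) = 0 ∧ u (-(m : ℝ) ^ a) = 0) {K : ℝ} (hK : 1 ≤ K)
    (hv : ∀ j, absMoment v j ≤ K ^ (j + 1)) :
    ∃ R : ℝ, ∀ x, R < |x| → u x = 0 := by
  have hA : 0 < 1 / a - 1 := by
    have := (one_lt_div ha.1).2 ha.2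
    linarith
  set A := 1 / a - 1
  set G := 4 * Real.exp 1 * Real.pi * K with hG
  have hK0 : 0 < K := by linarith
  have hG0 : 0 < G := by have := Real.pi_pos; positivity
  refine ⟨max 1 (G ^ A⁻¹), fun x hx => ?_⟩
  obtain ⟨hx1, hx2⟩ := max_lt_iff.1 hx
  have hx0 : 0 < |x| := by linarith
  set r := |x| ^ A with hr
  have hGr : G < r := by
    have := Real.rpow_lt_rpow (by positivity) hx2 hA
    rwa [← Real.rpow_mul hG0.le, inv_mul_cancel₀ hA.ne', Real.rpow_one] at this
  have hr0 : 0 < r := hG0.trans hGr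
  by_contra hne
  have hpos : 0 < ‖u x‖ / K := by positivity
  obtain ⟨n, hn⟩ := exists_pow_lt_of_lt_one hpos ((div_lt_one hr0).2 hGr)
  have h1 := fourier_mul_rpow_le ha v huv hz n hx1.le
  rw [Real.rpow_mul_natCast hx0.le] at h1
  have h2 : ‖u x‖ * r ^ n ≤ G ^ n * K := by
    calc _ ≤ (4 * Real.exp 1 * Real.pi) ^ n * absMoment v n := h1
      _ ≤ (4 * Real.exp 1 * Real.pi) ^ n * K ^ (n + 1) := by
        have := Real.pi_pos
        gcongr
        exact hv n
      _ = G ^ n * K := by rw [hG, mul_pow _ K]; ring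
  rw [div_pow, div_lt_div_iff₀ (by positivity) hK0] at hn
  linarith

theorem exists_norm_le_exp_neg_rpow {u : ℝ → ℂ} {M R p : ℝ} (hM : ∀ x, ‖u x‖ ≤ M)
    (hu : ∀ x, R < |x| → u x = 0) (hp : 0 ≤ p) :
    ∃ C > 0, ∀ x, ‖u x‖ ≤ C * Real.exp (-1 * |x| ^ p) := by
  have hM0 : 0 ≤ M := (norm_nonneg _).trans (hM 0)
  refine ⟨(M + 1) * Real.exp (R ^ p), by positivity, fun x => ?_⟩
  rcases lt_or_ge R |x| with h | h
  · rw [hu x h, norm_zero]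
    positivity
  · rw [mul_assoc, ← Real.exp_add]
    have h1 : |x| ^ p ≤ R ^ p := by gcongr
    have h2 : 1 ≤ Real.exp (R ^ p + -1 * |x| ^ p) := Real.one_le_exp (by linarith)
    nlinarith [hM x]

open FourierTransform in
theorem fourierTransform_eq_fourier_neg (f : ℝ → ℂ) (ξ : ℝ) :
    fourierTransform f ξ = 𝓕 f (-ξ) := by
  rw [← Real.fourierInv_eq_fourier_neg, Real.fourierInv_eq', fourierTransform]
  congr 1
  funext x
  rw [smul_eq_mul, mul_comm]
  congr 2
  simp
  ring

open FourierTransform in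
theorem optimal_exponential_decay (α β : ℝ)
    (hα : α ∈ Set.Ioo (0 : ℝ) 1) (hβ : β ∈ Set.Ioo (0 : ℝ) 1) (hsum : α + β < 1)
    (f : SchwartzMap ℝ ℂ)
    (hf : ∀ n : ℕ, f ((n : ℝ) ^ α) = 0 ∧ f (-(n : ℝ) ^ α) = 0)
    (hfhat : ∀ n : ℕ, fourierTransform f ((n : ℝ) ^ β) = 0 ∧
      fourierTransform f (-(n : ℝ) ^ β) = 0) :
    ∀ ε > 0, ∃ C > 0, ∃ c > 0,
      (∀ x : ℝ, ‖f x‖ ≤ C * Real.exp (-c * |x| ^ (1 / (α / (1 - α - β) + ε)))) ∧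
      (∀ ξ : ℝ, ‖fourierTransform f ξ‖ ≤
        C * Real.exp (-c * |ξ| ^ (1 / (β / (1 - α - β) + ε)))) := by
  intro ε hε
  have hα0 := hα.1
  have hβ0 := hβ.1
  set g : SchwartzMap ℝ ℂ := 𝓕 f with hg
  have hgf : (g : ℝ → ℂ) = 𝓕 (f : ℝ → ℂ) := rfl
  have hfg : (fun x => f (-x)) = 𝓕 (g : ℝ → ℂ) := by
    funext x
    have h := f.continuous.fourierInv_fourier_eq f.integrable (hgf ▸ g.integrable)
    rw [← congrFun h (-x), Real.fourierInv_eq_fourier_neg, neg_neg, hgf]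
  have hgz : ∀ m : ℕ, g ((m : ℝ) ^ β) = 0 ∧ g (-(m : ℝ) ^ β) = 0 := fun m => by
    have h := hfhat m
    rw [fourierTransform_eq_fourier_neg, fourierTransform_eq_fourier_neg, neg_neg, ← hgf] at h
    exact h.symm
  have hfz : ∀ m : ℕ, (fun x => f (-x)) ((m : ℝ) ^ α) = 0 ∧ (fun x => f (-x)) (-(m : ℝ) ^ α) = 0 :=
    fun m => ⟨(hf m).2, by simpa using (hf m).1⟩
  obtain ⟨D, hD, hDf⟩ := exists_absMoment_fourier_le hα g hfg hfz
  obtain ⟨D', hD', hDg⟩ := exists_absMoment_fourier_le hβ f hgf hgz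
  simp only [absMoment_comp_neg] at hDf
  have hA : 0 < 1 / α - 1 := by
    have := (one_lt_div hα.1).2 hα.2
    linarith
  have hB : 0 < 1 / β - 1 := by
    have := (one_lt_div hβ.1).2 hβ.2
    linarith
  have hAB : 1 < (1 / α - 1) * (1 / β - 1) := by
    have e : (1 / α - 1) * (1 / β - 1) = 1 + (1 - α - β) / (α * β) := by field_simp; ring
    have : 0 < (1 - α - β) / (α * β) := div_pos (by linarith) (by positivity)
    linarith
  obtain ⟨K, hK, hfK⟩ := exists_le_pow_of_mutually_recursive hA hB hAB hD hD'
    (fun j => by linarith [absMoment_nonneg f j]) hDf hDg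
  obtain ⟨K', hK', hgK⟩ := exists_le_pow_of_mutually_recursive hB hA (by linarith) hD' hD
    (fun j => by linarith [absMoment_nonneg g j]) hDg hDf
  obtain ⟨R, hfR⟩ := fourier_eq_zero_of_absMoment_le_pow hα g hfg hfz hK'
    fun j => by linarith [hgK j]
  obtain ⟨R', hgR⟩ := fourier_eq_zero_of_absMoment_le_pow hβ f hgf hgz hK
    fun j => by linarith [hfK j]
  have hγ : 0 < 1 - α - β := by linarith
  obtain ⟨C, hC, hfC⟩ := exists_norm_le_exp_neg_rpow (u := f)
    (p := 1 / (α / (1 - α - β) + ε)) (f.norm_le_seminorm ℝ)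
    (fun x hx => by simpa using hfR (-x) (by simpa using hx)) (by positivity)
  obtain ⟨C', hC', hgC⟩ := exists_norm_le_exp_neg_rpow (u := g)
    (p := 1 / (β / (1 - α - β) + ε)) (g.norm_le_seminorm ℝ) hgR (by positivity)
  refine ⟨C + C', by positivity, 1, one_pos, fun x => (hfC x).trans ?_, fun ξ => ?_⟩
  · gcongr
    linarith
  · rw [fourierTransform_eq_fourier_neg, ← hgf]
    refine (hgC (-ξ)).trans ?_
    rw [abs_neg]
    gcongr
    linarith
end

section
/- Let f : ℝ → ℂ be an integrable function such that for every natural number k both ∫_ℝ |f(x)| |x|^k dx < ∞ and ∫_ℝ |f̂(ξ)| |ξ|^k dξ < ∞, where f̂(ξ) = ∫_ℝ f(x) e^{2πi x ξ} dx. Then f agrees almost everywhere with a Schwartz function. -/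
open MeasureTheory

open scoped FourierTransform ContDiff

section Decay

variable {E : Type*} [NormedAddCommGroup E]

theorem one_add_abs_pow_le_two_pow_mul {x y : ℝ} (h : |x - y| ≤ 1) (k : ℕ) :
    (1 + |x|) ^ k ≤ 2 ^ k * (1 + |y|) ^ k := by
  rw [← mul_pow]
  gcongr
  linarith [abs_sub_abs_le_abs_sub x y, abs_nonneg y]

theorem rapid_decay_increments_of_rapid_decay {u : ℝ → E}
    (hu : ∀ k : ℕ, ∃ C : ℝ, ∀ x, (1 + |x|) ^ k * ‖u x‖ ≤ C) (k : ℕ) :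
    ∃ C : ℝ, ∀ x δ : ℝ, 0 ≤ δ → δ ≤ 1 → (1 + |x|) ^ k * ‖u (x + δ) - u x‖ ≤ C := by
  obtain ⟨C, hC⟩ := hu k
  refine ⟨2 ^ k * C + C, fun x δ hδ0 hδ1 => ?_⟩
  have hx : |x - (x + δ)| ≤ 1 := by
    rw [sub_add_cancel_left, abs_neg, abs_of_nonneg hδ0]
    exact hδ1
  calc (1 + |x|) ^ k * ‖u (x + δ) - u x‖
      ≤ (1 + |x|) ^ k * (‖u (x + δ)‖ + ‖u x‖) := by gcongr; exact norm_sub_le _ _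
    _ = (1 + |x|) ^ k * ‖u (x + δ)‖ + (1 + |x|) ^ k * ‖u x‖ := mul_add _ _ _
    _ ≤ 2 ^ k * (1 + |x + δ|) ^ k * ‖u (x + δ)‖ + C := by
        gcongr
        · exact one_add_abs_pow_le_two_pow_mul hx k
        · exact hC x
    _ ≤ 2 ^ k * C + C := by
        rw [mul_assoc]
        gcongr
        exact hC _

theorem integrable_one_add_abs_pow_mul_norm {u : ℝ → E}
    (hu : ∀ k : ℕ, Integrable fun x => ‖u x‖ * |x| ^ k) (k : ℕ) :
    Integrable fun x => (1 + |x|) ^ k * ‖u x‖ := by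
  have h : (fun x : ℝ => (1 + |x|) ^ k * ‖u x‖) =
      fun x => ∑ m ∈ Finset.range (k + 1), (k.choose m : ℝ) * (‖u x‖ * |x| ^ m) := by
    ext x
    rw [add_comm, add_pow, Finset.sum_mul]
    refine Finset.sum_congr rfl fun m _ => ?_
    ring
  rw [h]
  exact integrable_finsetSum _ fun m _ => (hu m).const_mul _

variable [NormedSpace ℝ E]

/-- If the increments of `U` over intervals of length at most one decay rapidly and the derivative
`u` of `U` is Lipschitz, then `u` decays rapidly. -/
theorem rapid_decay_of_increments {U u : ℝ → E} {M : ℝ} (hU : ∀ x, HasDerivAt U (u x) x)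
    (hu : Differentiable ℝ u) (hM : ∀ x, ‖deriv u x‖ ≤ M)
    (hinc : ∀ k : ℕ, ∃ C : ℝ, ∀ x δ : ℝ, 0 ≤ δ → δ ≤ 1 →
      (1 + |x|) ^ k * ‖U (x + δ) - U x‖ ≤ C) (k : ℕ) :
    ∃ C : ℝ, ∀ x, (1 + |x|) ^ k * ‖u x‖ ≤ C := by
  obtain ⟨C, hC⟩ := hinc (2 * k)
  refine ⟨C + M, fun x => ?_⟩
  have hw : 1 ≤ (1 + |x|) ^ k := one_le_pow₀ (by linarith [abs_nonneg x])
  have hC' : ∀ δ : ℝ, 0 ≤ δ → δ ≤ 1 →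
      ((1 + |x|) ^ k) ^ 2 * ‖U (x + δ) - U x‖ ≤ C := by
    simpa only [← pow_mul, mul_comm k 2] using hC x
  generalize (1 + |x|) ^ k = w at hw hC'
  have hw0 : 0 < w := one_pos.trans_le hw
  have hδ0 : 0 ≤ w⁻¹ := by positivity
  replace hC' := hC' w⁻¹ hδ0 (inv_le_one_of_one_le₀ hw)
  have hM0 : 0 ≤ M := (norm_nonneg _).trans (hM 0)
  have hlip : ∀ y, ‖u y - u x‖ ≤ M * ‖y - x‖ := fun y =>
    convex_univ.norm_image_sub_le_of_norm_hasDerivWithin_le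
      (fun z _ => (hu z).hasDerivAt.hasDerivWithinAt) (fun z _ => hM z)
      (Set.mem_univ x) (Set.mem_univ y)
  have htaylor : ‖U (x + w⁻¹) - U x - w⁻¹ • u x‖ ≤ M * w⁻¹ * w⁻¹ := by
    have h := (convex_Icc x (x + w⁻¹)).norm_image_sub_le_of_norm_hasDerivWithin_le
      (f := fun y => U y - y • u x) (f' := fun y => u y - (1 : ℝ) • u x) (C := M * w⁻¹)
      (fun y _ => ((hU y).sub ((hasDerivAt_id y).smul_const (u x))).hasDerivWithinAt)
      (fun y hy => by
        rw [one_smul]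
        refine (hlip y).trans (mul_le_mul_of_nonneg_left ?_ hM0)
        rw [Real.norm_eq_abs, abs_of_nonneg (by linarith [hy.1])]
        linarith [hy.2])
      (Set.left_mem_Icc.2 (by linarith)) (Set.right_mem_Icc.2 (by linarith))
    rw [add_sub_cancel_left, Real.norm_of_nonneg hδ0] at h
    convert h using 2
    rw [add_smul]
    abel
  have hsplit : w⁻¹ * ‖u x‖ ≤ ‖U (x + w⁻¹) - U x‖ + M * w⁻¹ * w⁻¹ := by
    calc w⁻¹ * ‖u x‖ = ‖w⁻¹ • u x‖ := by rw [norm_smul, Real.norm_of_nonneg hδ0]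
      _ = ‖(U (x + w⁻¹) - U x) - (U (x + w⁻¹) - U x - w⁻¹ • u x)‖ := by rw [sub_sub_cancel]
      _ ≤ _ := (norm_sub_le _ _).trans (by gcongr)
  calc w * ‖u x‖ = w ^ 2 * (w⁻¹ * ‖u x‖) := by field_simp
    _ ≤ w ^ 2 * (‖U (x + w⁻¹) - U x‖ + M * w⁻¹ * w⁻¹) := by gcongr
    _ = w ^ 2 * ‖U (x + w⁻¹) - U x‖ + M := by field_simp
    _ ≤ C + M := by gcongr

theorem rapid_decay_increments_of_integrable [CompleteSpace E] {u : ℝ → E}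
    (hu : Continuous u) (hint : ∀ k : ℕ, Integrable fun x => ‖u x‖ * |x| ^ k) (k : ℕ) :
    ∃ C : ℝ, ∀ x δ : ℝ, 0 ≤ δ → δ ≤ 1 →
      (1 + |x|) ^ k * ‖(∫ t in (0 : ℝ)..x + δ, u t) - ∫ t in (0 : ℝ)..x, u t‖ ≤ C := by
  have hw := integrable_one_add_abs_pow_mul_norm hint k
  refine ⟨∫ y, 2 ^ k * ((1 + |y|) ^ k * ‖u y‖), fun x δ hδ0 hδ1 => ?_⟩
  have hle : x ≤ x + δ := by linarith
  rw [intervalIntegral.integral_interval_sub_left (hu.intervalIntegrable _ _)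
    (hu.intervalIntegrable _ _)]
  calc (1 + |x|) ^ k * ‖∫ t in x..x + δ, u t‖
      ≤ (1 + |x|) ^ k * ∫ t in x..x + δ, ‖u t‖ := by
        gcongr
        exact intervalIntegral.norm_integral_le_integral_norm hle
    _ = ∫ t in x..x + δ, (1 + |x|) ^ k * ‖u t‖ :=
        (intervalIntegral.integral_const_mul _ _).symm
    _ ≤ ∫ t in x..x + δ, 2 ^ k * ((1 + |t|) ^ k * ‖u t‖) := by
        refine intervalIntegral.integral_mono_on hle
          ((hu.norm.const_mul _).intervalIntegrable _ _)
          (hw.const_mul _).intervalIntegrable fun t ht => ?_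
        rw [← mul_assoc]
        gcongr
        refine one_add_abs_pow_le_two_pow_mul (abs_le.2 ⟨?_, ?_⟩) k <;> linarith [ht.1, ht.2]
    _ ≤ ∫ y, 2 ^ k * ((1 + |y|) ^ k * ‖u y‖) := by
        rw [intervalIntegral.integral_of_le hle]
        exact setIntegral_le_integral (hw.const_mul _) (ae_of_all _ fun y => by positivity)

/-- A smooth function with bounded derivatives and integrable moments is a Schwartz function. -/
theorem exists_schwartzMap_of_bounded_derivatives [CompleteSpace E] {u : ℝ → E}
    (hu : ContDiff ℝ ∞ u) (hbdd : ∀ n : ℕ, ∃ M : ℝ, ∀ x, ‖iteratedDeriv n u x‖ ≤ M)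
    (hint : ∀ k : ℕ, Integrable fun x => ‖u x‖ * |x| ^ k) :
    ∃ g : SchwartzMap ℝ E, ⇑g = u := by
  have hdiff (n : ℕ) : Differentiable ℝ (iteratedDeriv n u) :=
    hu.differentiable_iteratedDeriv n (by exact_mod_cast WithTop.coe_lt_top n)
  have hderiv (n : ℕ) : ∃ M : ℝ, ∀ x, ‖deriv (iteratedDeriv n u) x‖ ≤ M := by
    simpa only [iteratedDeriv_succ] using hbdd (n + 1)
  have hdecay (n : ℕ) : ∀ k : ℕ, ∃ C : ℝ, ∀ x, (1 + |x|) ^ k * ‖iteratedDeriv n u x‖ ≤ C := by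
    induction n with
    | zero =>
      obtain ⟨M, hM⟩ := hderiv 0
      have hd := hdiff 0
      rw [iteratedDeriv_zero] at hM hd ⊢
      exact rapid_decay_of_increments
        (fun x => intervalIntegral.integral_hasDerivAt_right (hu.continuous.intervalIntegrable _ _)
          (hu.continuous.stronglyMeasurableAtFilter _ _) hu.continuous.continuousAt)
        hd hM (rapid_decay_increments_of_integrable hu.continuous hint)
    | succ n ih =>
      obtain ⟨M, hM⟩ := hderiv (n + 1)
      refine rapid_decay_of_increments (fun x => ?_) (hdiff (n + 1)) hM
        (rapid_decay_increments_of_rapid_decay ih)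
      rw [iteratedDeriv_succ]
      exact (hdiff n x).hasDerivAt
  refine ⟨⟨u, hu, fun k n => ?_⟩, rfl⟩
  obtain ⟨C, hC⟩ := hdecay n k
  refine ⟨C, fun x => le_trans ?_ (hC x)⟩
  rw [norm_iteratedFDeriv_eq_norm_iteratedDeriv, Real.norm_eq_abs]
  gcongr
  linarith

end Decay

/-- An integrable function whose Fourier transform vanishes is zero almost everywhere. -/
theorem ae_eq_zero_of_fourier_eq_zero {f : ℝ → ℂ} (hf : Integrable f) (h : 𝓕 f = 0) :
    ∀ᵐ x, f x = 0 := by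
  refine ae_eq_zero_of_integral_contDiff_smul_eq_zero hf.locallyIntegrable fun φ hφ hsupp => ?_
  have hsupp' : HasCompactSupport fun x => (φ x : ℂ) :=
    hsupp.comp_left (g := ((↑) : ℝ → ℂ)) Complex.ofReal_zero
  let Φ : SchwartzMap ℝ ℂ := hsupp'.toSchwartzMap (Complex.ofRealCLM.contDiff.comp hφ)
  have hflip : ∫ x, 𝓕 (𝓕⁻ Φ : SchwartzMap ℝ ℂ) x • f x =
      ∫ x, (𝓕⁻ Φ : SchwartzMap ℝ ℂ) x • 𝓕 f x := by
    have := VectorFourier.integral_fourierIntegral_smul_eq_flip (L := innerₗ ℝ)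
      Real.continuous_fourierChar continuous_inner ((𝓕⁻ Φ : SchwartzMap ℝ ℂ).integrable (μ := volume)) hf
    rw [flip_innerₗ] at this
    exact this
  rw [h, FourierTransform.fourier_fourierInv_eq] at hflip
  simp only [Pi.zero_apply, smul_zero, integral_zero] at hflip
  exact hflip

theorem fourierTransform_neg (f : ℝ → ℂ) (ξ : ℝ) : fourierTransform f (-ξ) = 𝓕 f ξ := by
  rw [Real.fourier_real_eq_integral_exp_smul, fourierTransform]
  congr 1 with x
  rw [smul_eq_mul, mul_comm]
  congr 2
  push_cast
  ring

theorem schwartz_from_weighted_integrability (f : ℝ → ℂ)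
    (hint : Integrable f)
    (hf : ∀ k : ℕ, Integrable (fun x : ℝ => ‖f x‖ * |x| ^ k))
    (hfhat : ∀ k : ℕ, Integrable (fun ξ : ℝ => ‖fourierTransform f ξ‖ * |ξ| ^ k)) :
    ∃ g : SchwartzMap ℝ ℂ, ∀ᵐ x : ℝ, f x = g x := by
  have hmom (k : ℕ) : Integrable fun x : ℝ => x ^ k • f x := by
    refine (hf k).mono' (by fun_prop) (ae_of_all _ fun x => ?_)
    rw [norm_smul, norm_pow, Real.norm_eq_abs, mul_comm]
  have hsmooth : ContDiff ℝ ∞ (𝓕 f) :=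
    Real.contDiff_fourier (N := ⊤) fun k _ => by simpa [norm_smul] using (hmom k).norm
  have hbdd (n : ℕ) : ∃ M : ℝ, ∀ x, ‖iteratedDeriv n (𝓕 f) x‖ ≤ M := by
    rw [Real.iteratedDeriv_fourier (N := ⊤) (fun k _ => hmom k) le_top]
    exact ⟨_, fun x => VectorFourier.norm_fourierIntegral_le_integral_norm _ _ _ _ x⟩
  have hhat (k : ℕ) : Integrable fun ξ : ℝ => ‖𝓕 f ξ‖ * |ξ| ^ k := by
    simpa only [fourierTransform_neg, abs_neg] using (hfhat k).comp_neg
  obtain ⟨F, hF⟩ := exists_schwartzMap_of_bounded_derivatives hsmooth hbdd hhat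
  let g : SchwartzMap ℝ ℂ := 𝓕⁻ F
  have hg : 𝓕 (g : ℝ → ℂ) = 𝓕 f := by
    rw [← SchwartzMap.fourier_coe, FourierTransform.fourier_fourierInv_eq, hF]
  refine ⟨g, ?_⟩
  have hzero : 𝓕 (f - ⇑g) = 0 := by
    have hadd : 𝓕 (f - ⇑g + ⇑g) = 𝓕 (f - ⇑g) + 𝓕 ⇑g :=
      VectorFourier.fourierIntegral_add (L := innerₗ ℝ) Real.continuous_fourierChar
        continuous_inner (hint.sub g.integrable) g.integrable
    rwa [sub_add_cancel, hg, right_eq_add] at hadd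
  filter_upwards [ae_eq_zero_of_fourier_eq_zero (hint.sub g.integrable) hzero] with x hx
  exact sub_eq_zero.1 hx
end
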